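/- arXiv:2210.14312 — 2 statements merged into one kernel-verified Lean document; each statement's English description precedes it below -/
import Mathlib

section
/- Let n ≥ 1, let P₀, P₁, …, Pₙ ∈ ℝⁿ, let S = convexHull{P₀, …, Pₙ}, and let f : ℝⁿ → ℝ be an affine map. Then ∫_S f dx = vol(S) · (f(P₀) + f(P₁) + ⋯ + f(Pₙ))/(n+1), where vol denotes Lebesgue measure on ℝⁿ and the integral is with respect to Lebesgue measure. -/
open MeasureTheory

namespace AffineBasis

variable {ι E : Type*} [NormedAddCommGroup E] [NormedSpace ℝ E]

/-- The affine map exchanging the points `b i` and `b j` and fixing all other points of the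
affine basis `b`. -/
noncomputable def swapMap (b : AffineBasis ι ℝ E) (i j : ι) : E →ᵃ[ℝ] E :=
  AffineMap.id ℝ E +
    (LinearMap.toSpanSingleton ℝ E (b j - b i)).toAffineMap.comp (b.coord i - b.coord j)

theorem swapMap_apply_basis [DecidableEq ι] (b : AffineBasis ι ℝ E) (i j k : ι) :
    b.swapMap i j (b k) = b (Equiv.swap i j k) := by
  rcases eq_or_ne i j with rfl | hij
  · simp [swapMap]
  rcases eq_or_ne k i with rfl | hki
  · simp [swapMap, hij.symm]
  rcases eq_or_ne k j with rfl | hkj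
  · simp [swapMap, hij]
  · simp [swapMap, Equiv.swap_apply_of_ne_of_ne hki hkj, hki.symm, hkj.symm]

theorem swapMap_comp_self (b : AffineBasis ι ℝ E) (i j : ι) :
    (b.swapMap i j).comp (b.swapMap i j) = AffineMap.id ℝ E := by
  classical
  refine AffineMap.ext_on b.tot ?_
  rintro _ ⟨k, rfl⟩
  simp [swapMap_apply_basis]

theorem coord_comp_swapMap (b : AffineBasis ι ℝ E) (i j : ι) :
    (b.coord i).comp (b.swapMap i j) = b.coord j := by
  classical
  refine AffineMap.ext_on b.tot ?_
  rintro _ ⟨k, rfl⟩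
  have h : i = Equiv.swap i j k ↔ j = k := by
    rw [eq_comm, Equiv.swap_apply_eq_iff, Equiv.swap_apply_left, eq_comm]
  simp only [AffineMap.comp_apply, swapMap_apply_basis, coord_apply, h]

theorem swapMap_image_convexHull (b : AffineBasis ι ℝ E) (i j : ι) :
    b.swapMap i j '' convexHull ℝ (Set.range b) = convexHull ℝ (Set.range b) := by
  classical
  rw [AffineMap.image_convexHull, ← Set.range_comp]
  have h : b.swapMap i j ∘ b = b ∘ Equiv.swap i j := funext (b.swapMap_apply_basis i j)
  rw [h, (Equiv.swap i j).surjective.range_comp]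

theorem abs_det_swapMap_linear (b : AffineBasis ι ℝ E) (i j : ι) :
    |LinearMap.det (b.swapMap i j).linear| = 1 := by
  have h := congrArg AffineMap.linear (b.swapMap_comp_self i j)
  have h2 := congrArg LinearMap.det h
  rw [AffineMap.comp_linear, LinearMap.det_comp, AffineMap.id_linear, LinearMap.det_id] at h2
  rw [← abs_one, ← sq_eq_sq_iff_abs_eq_abs]
  linarith

theorem apply_eq_sum_mul_coord [Fintype ι] (b : AffineBasis ι ℝ E) (f : E →ᵃ[ℝ] ℝ) (x : E) :
    f x = ∑ i, f (b i) * b.coord i x := by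
  have h := congrArg f (b.affineCombination_coord_eq_self x)
  rw [Finset.map_affineCombination _ _ _ (b.sum_coord_apply_eq_one x),
    Finset.univ.affineCombination_eq_linear_combination _ _ (b.sum_coord_apply_eq_one x)] at h
  simpa [mul_comm] using h.symm

variable [Fintype ι] [FiniteDimensional ℝ E] [MeasurableSpace E] [BorelSpace E]
  (μ : Measure E) [μ.IsAddHaarMeasure]

/-- All barycentric coordinates have the same integral over a simplex. -/
theorem setIntegral_coord_eq (b : AffineBasis ι ℝ E) (i j : ι) :
    ∫ x in convexHull ℝ (Set.range b), b.coord i x ∂μ =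
      ∫ x in convexHull ℝ (Set.range b), b.coord j x ∂μ := by
  have hS : MeasurableSet (convexHull ℝ (Set.range b)) :=
    ((Set.finite_range b).isCompact_convexHull ℝ).measurableSet
  have hinv : Function.Involutive (b.swapMap i j) :=
    fun x => congrArg (fun g : E →ᵃ[ℝ] E => g x) (b.swapMap_comp_self i j)
  have hder (x : E) : HasFDerivAt (b.swapMap i j)
      (LinearMap.toContinuousLinearMap (b.swapMap i j).linear) x := by
    rw [AffineMap.decomp (b.swapMap i j)]
    exact (LinearMap.toContinuousLinearMap (b.swapMap i j).linear).hasFDerivAt.add_const _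
  have h := integral_image_eq_integral_abs_det_fderiv_smul μ hS
    (fun x _ => (hder x).hasFDerivWithinAt) hinv.injective.injOn (b.coord i)
  rw [swapMap_image_convexHull] at h
  rw [h]
  refine integral_congr_ae (.of_forall fun x => ?_)
  have hx : b.coord i (b.swapMap i j x) = b.coord j x :=
    congrArg (fun g : E →ᵃ[ℝ] ℝ => g x) (b.coord_comp_swapMap i j)
  simp [hx, ContinuousLinearMap.det, abs_det_swapMap_linear]

theorem integrableOn_convexHull (b : AffineBasis ι ℝ E) (f : E →ᵃ[ℝ] ℝ) :
    IntegrableOn f (convexHull ℝ (Set.range b)) μ :=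
  f.continuous_of_finiteDimensional.continuousOn.integrableOn_compact
    ((Set.finite_range b).isCompact_convexHull ℝ)

theorem card_mul_setIntegral_coord (b : AffineBasis ι ℝ E) (i : ι) :
    Fintype.card ι * ∫ x in convexHull ℝ (Set.range b), b.coord i x ∂μ =
      μ.real (convexHull ℝ (Set.range b)) := by
  calc Fintype.card ι * ∫ x in convexHull ℝ (Set.range b), b.coord i x ∂μ
      = ∑ j, ∫ x in convexHull ℝ (Set.range b), b.coord j x ∂μ := by
        simp [fun j => b.setIntegral_coord_eq μ j i]
    _ = ∫ x in convexHull ℝ (Set.range b), ∑ j, b.coord j x ∂μ :=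
        (integral_finsetSum _ fun j _ => b.integrableOn_convexHull μ (b.coord j)).symm
    _ = μ.real (convexHull ℝ (Set.range b)) := by simp

/-- The integral of an affine map over a simplex is the volume times the average of the values
at the vertices. -/
theorem setIntegral_convexHull (b : AffineBasis ι ℝ E) (f : E →ᵃ[ℝ] ℝ) :
    ∫ x in convexHull ℝ (Set.range b), f x ∂μ =
      μ.real (convexHull ℝ (Set.range b)) * ((∑ i, f (b i)) / Fintype.card ι) := by
  have hcard : (Fintype.card ι : ℝ) ≠ 0 := by
    have := b.nonempty
    exact_mod_cast Fintype.card_ne_zero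
  rw [integral_congr_ae (.of_forall (b.apply_eq_sum_mul_coord f)),
    integral_finsetSum _ fun i _ => (b.integrableOn_convexHull μ (b.coord i)).const_mul _,
    Finset.sum_div, Finset.mul_sum]
  refine Finset.sum_congr rfl fun i _ => ?_
  rw [integral_const_mul, ← b.card_mul_setIntegral_coord μ i]
  field_simp

end AffineBasis

/-- Simplex quadrature rule: an affine map integrates over a simplex to the volume
times the average of the vertex values. -/
theorem stmt_14 (n : ℕ) (hn : 1 ≤ n) (P : Fin (n + 1) → (Fin n → ℝ))
    (f : (Fin n → ℝ) →ᵃ[ℝ] ℝ) :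
    ∫ x in convexHull ℝ (Set.range P), f x =
      (volume (convexHull ℝ (Set.range P))).toReal *
        ((∑ i : Fin (n + 1), f (P i)) / (n + 1)) := by
  by_cases htop : affineSpan ℝ (Set.range P) = ⊤
  · have hind : AffineIndependent ℝ P := by
      rw [affineIndependent_iff_finrank_vectorSpan_eq ℝ P (Fintype.card_fin (n + 1)),
        ← direction_affineSpan, htop, AffineSubspace.direction_top, finrank_top,
        Module.finrank_fin_fun]
    have h := AffineBasis.setIntegral_convexHull volume (⟨P, hind, htop⟩ : AffineBasis _ ℝ _) f
    rw [Fintype.card_fin, Nat.cast_succ] at h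
    exact h
  · have hzero : volume (convexHull ℝ (Set.range P)) = 0 :=
      measure_mono_null (convexHull_subset_affineSpan _)
        (Measure.addHaar_affineSubspace volume _ htop)
    rw [Measure.restrict_eq_zero.mpr hzero, hzero]
    simp
end

section
/- Define the five tetrahedra of the middle-cut triangulation of the unit cube in ℝ³: S₁ = convexHull{(0,0,0),(1,0,0),(0,1,0),(0,0,1)}, S₂ = convexHull{(1,1,0),(1,0,0),(0,1,0),(1,1,1)}, S₃ = convexHull{(1,0,1),(1,0,0),(1,1,1),(0,0,1)}, S₄ = convexHull{(0,1,1),(1,1,1),(0,1,0),(0,0,1)}, S₅ = convexHull{(1,1,1),(1,0,0),(0,1,0),(0,0,1)}. Then S₁ ∪ S₂ ∪ S₃ ∪ S₄ ∪ S₅ = [0,1]³. -/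
theorem mem_convexHull_four {E : Type*} [AddCommGroup E] [Module ℝ E] {p q r s x : E}
    (a b c d : ℝ) (ha : 0 ≤ a) (hb : 0 ≤ b) (hc : 0 ≤ c) (hd : 0 ≤ d)
    (hsum : a + b + c + d = 1) (hx : a • p + b • q + c • r + d • s = x) :
    x ∈ convexHull ℝ ({p, q, r, s} : Set E) := by
  have h := (convex_convexHull ℝ ({p, q, r, s} : Set E)).sum_mem (t := Finset.univ)
    (w := ![a, b, c, d]) (z := ![p, q, r, s])
    (by intro i _; fin_cases i <;> simpa)
    (by simpa [Fin.sum_univ_four] using hsum)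
    (by intro i _; apply subset_convexHull; fin_cases i <;> simp)
  simpa [Fin.sum_univ_four, hx] using h

/-- The five tetrahedra of the middle-cut triangulation cover the unit cube. -/
theorem stmt_16 :
    convexHull ℝ ({![0,0,0], ![1,0,0], ![0,1,0], ![0,0,1]} : Set (Fin 3 → ℝ)) ∪
      convexHull ℝ ({![1,1,0], ![1,0,0], ![0,1,0], ![1,1,1]} : Set (Fin 3 → ℝ)) ∪
      convexHull ℝ ({![1,0,1], ![1,0,0], ![1,1,1], ![0,0,1]} : Set (Fin 3 → ℝ)) ∪
      convexHull ℝ ({![0,1,1], ![1,1,1], ![0,1,0], ![0,0,1]} : Set (Fin 3 → ℝ)) ∪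
      convexHull ℝ ({![1,1,1], ![1,0,0], ![0,1,0], ![0,0,1]} : Set (Fin 3 → ℝ)) =
      Set.Icc ![0,0,0] ![1,1,1] := by
  apply Set.Subset.antisymm
  · simp only [Set.union_subset_iff]
    refine ⟨⟨⟨⟨?_, ?_⟩, ?_⟩, ?_⟩, ?_⟩ <;> refine convexHull_min ?_ (convex_Icc _ _) <;>
      simp [Set.insert_subset_iff, Pi.le_def, Fin.forall_fin_succ]
  · rintro v ⟨h0, h1⟩
    obtain ⟨x, y, z, rfl⟩ : ∃ x y z, v = ![x, y, z] :=
      ⟨v 0, v 1, v 2, by ext i; fin_cases i <;> rfl⟩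
    simp only [Pi.le_def, Fin.forall_fin_succ] at h0 h1
    simp at h0 h1
    obtain ⟨hx, hy, hz⟩ := h0
    obtain ⟨hx', hy', hz'⟩ := h1
    by_cases h₁ : x + y + z ≤ 1
    · refine .inl <| .inl <| .inl <| .inl <| mem_convexHull_four (1 - x - y - z) x y z
        ?_ ?_ ?_ ?_ ?_ ?_ <;> first | linarith | (ext i; fin_cases i <;> simp)
    by_cases h₂ : 1 ≤ x + y - z
    · refine .inl <| .inl <| .inl <| .inr <| mem_convexHull_four (x + y - z - 1) (1 - y) (1 - x) z
        ?_ ?_ ?_ ?_ ?_ ?_ <;> first | linarith | (ext i; fin_cases i <;> simp <;> ring)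
    by_cases h₃ : 1 ≤ x + z - y
    · refine .inl <| .inl <| .inr <| mem_convexHull_four (x + z - y - 1) (1 - z) y (1 - x)
        ?_ ?_ ?_ ?_ ?_ ?_ <;> first | linarith | (ext i; fin_cases i <;> simp <;> ring)
    by_cases h₄ : 1 ≤ y + z - x
    · refine .inl <| .inr <| mem_convexHull_four (y + z - x - 1) x (1 - z) (1 - y)
        ?_ ?_ ?_ ?_ ?_ ?_ <;> first | linarith | (ext i; fin_cases i <;> simp <;> ring)
    · refine .inr <| mem_convexHull_four ((x + y + z - 1) / 2) ((x - y - z + 1) / 2)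
        ((y - x - z + 1) / 2) ((z - x - y + 1) / 2)
        ?_ ?_ ?_ ?_ ?_ ?_ <;> first | linarith | (ext i; fin_cases i <;> simp <;> ring)
end
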